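/- Let L be a unimodular lattice in ℝ^n having no vectors of norm 1, and suppose every characteristic vector w of L has norm ⟪w,w⟫ ≥ n − 8. Then the set of characteristic vectors of L of norm exactly n − 8 is finite and its cardinality equals 2^(n−11) · n (an equality of real numbers, where 2^(n−11) is interpreted as a real power so that it is meaningful also for n < 11). -/

import Mathlib

open scoped RealInnerProductSpace

/-- A unimodular (self-dual) lattice in `ℝⁿ`: a `ℤ`-submodule of Euclidean space that is
discrete, spans `ℝⁿ` over `ℝ`, and is self-dual: a vector `v` belongs to the lattice iff
its inner product with every lattice vector is an integer. -/
def IsUnimodularLattice (n : ℕ) (L : Submodule ℤ (EuclideanSpace ℝ (Fin n))) : Prop :=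
  DiscreteTopology L ∧
  Submodule.span ℝ (L : Set (EuclideanSpace ℝ (Fin n))) = ⊤ ∧
  ∀ v : EuclideanSpace ℝ (Fin n), v ∈ L ↔ ∀ y ∈ L, ∃ k : ℤ, ⟪v, y⟫ = (k : ℝ)

/-- A characteristic vector of a lattice `L`: a vector `w ∈ L` with
`⟪w,x⟫ ≡ ⟪x,x⟫ (mod 2)` for all `x ∈ L`. -/
def IsCharacteristic (n : ℕ) (L : Submodule ℤ (EuclideanSpace ℝ (Fin n)))
    (w : EuclideanSpace ℝ (Fin n)) : Prop :=
  w ∈ L ∧ ∀ x ∈ L, ∃ k : ℤ, ⟪w, x⟫ - ⟪x, x⟫ = 2 * (k : ℝ)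

section Helpers

open Complex Filter Topology Asymptotics Real
open UpperHalfPlane hiding I
open ModularForm MatrixGroups Manifold

theorem disc_S (τ : ℍ) : discriminant (ModularGroup.S • τ) = (τ:ℂ)^12 * discriminant τ := by
  have h := congrFun discriminant_S_invariant τ
  rw [SL_slash_apply, ModularGroup.denom_S] at h
  have h0 : (τ:ℂ) ≠ 0 := τ.ne_zero
  rw [← h]
  rw [zpow_neg, zpow_ofNat]
  field_simp

theorem disc_T (τ : ℍ) : discriminant (ModularGroup.T • τ) = discriminant τ := by
  have h := congrFun discriminant_T_invariant τ
  rw [SL_slash_apply, ModularGroup.denom_apply] at h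
  simpa [ModularGroup.T] using h

theorem weight_zero_zero (f : ℍ → ℂ) (hf : MDifferentiable 𝓘(ℂ) 𝓘(ℂ) f)
    (hS : ∀ τ, f (ModularGroup.S • τ) = f τ) (hT : ∀ τ, f (ModularGroup.T • τ) = f τ)
    (h0 : Tendsto f atImInfty (𝓝 0)) : ∀ τ, f τ = 0 := by
  have hsl : ∀ γ : SL(2, ℤ), f ∣[(0:ℤ)] γ = f := by
    apply SlashInvariantForm.slash_action_generators_SL2Z
    · ext τ; rw [SL_slash_apply]; simpa using hS τ
    · ext τ; rw [SL_slash_apply]; simpa using hT τ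
  let F : ModularForm 𝒮ℒ 0 :=
    { toFun := f
      slash_action_eq' := fun _ ⟨γ, hγ⟩ ↦ hγ ▸ hsl γ
      holo' := hf
      bdd_at_cusps' := by
        intro c hc
        rw [Subgroup.IsArithmetic.isCusp_iff_isCusp_SL2Z] at hc
        rw [OnePoint.isBoundedAt_iff_forall_SL2Z hc]
        intro γ _
        rw [hsl γ]
        exact h0.isBigO_one ℝ }
  obtain ⟨c, hc⟩ := ModularFormClass.levelOne_weight_zero_const F
  have hfc : f = Function.const _ c := hc
  have : c = 0 := by
    rw [hfc] at h0
    exact tendsto_nhds_unique tendsto_const_nhds h0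
  intro τ
  rw [hfc, this]; rfl

theorem partB (G : ℂ → ℂ) (m : ℕ) (hd : DifferentiableOn ℂ G {z | 0 < z.im})
    (h2 : ∀ z : ℂ, 0 < z.im → G (z+2) = G z)
    (hS : ∀ z : ℂ, 0 < z.im → G (-1/z) = z^(4*m) * G z)
    (hO : (fun τ : ℍ => G τ * G (τ+1) * (G (1-1/τ) / (τ:ℂ)^(4*m))) =o[atImInfty]
      (fun τ : ℍ => Real.exp (-2*π*τ.im)^m)) :
    ∀ z : ℂ, 0 < z.im → G z = 0 := by
  have him : ∀ z : ℂ, 0 < z.im → 0 < (-1/z).im := by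
    intro z hz
    have := UpperHalfPlane.im_inv_neg_coe_pos ⟨z, hz⟩
    rw [neg_div, one_div]
    simpa [inv_neg] using this
  have him1 : ∀ z : ℂ, 0 < z.im → 0 < (1-1/z).im := by
    intro z hz
    have := him z hz
    rw [neg_div] at this
    rw [sub_eq_add_neg, add_im]; simpa using this
  have hne : ∀ z : ℂ, 0 < z.im → z ≠ 0 := by
    rintro z hz rfl; simp at hz
  set P : ℂ → ℂ := fun z => G z * G (z+1) * (G (1-1/z) / z^(4*m)) with hP
  have hd2 : DifferentiableOn ℂ (fun z => G (z+1)) {z | 0 < z.im} :=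
    hd.comp (by fun_prop) (fun z hz => by simpa using hz)
  have hd3 : DifferentiableOn ℂ (fun z => G (1-1/z)) {z | 0 < z.im} := by
    refine hd.comp (t := {z : ℂ | 0 < z.im}) ?_ (fun z hz => him1 z hz)
    intro z hz
    have := hne z hz
    exact (differentiableWithinAt_const _).sub ((differentiableWithinAt_const _).div differentiableWithinAt_id this)
  have hd4 : DifferentiableOn ℂ (fun z : ℂ => G (1-1/z) / z^(4*m)) {z | 0 < z.im} := by
    refine hd3.div (by fun_prop) (fun z hz => pow_ne_zero _ (hne z hz))
  have hPd : DifferentiableOn ℂ P {z | 0 < z.im} := (hd.mul hd2).mul hd4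
  have hPS : ∀ z : ℂ, 0 < z.im → P (-1/z) = z^(12*m) * P z := by
    intro z hz
    have h0 := hne z hz
    simp only [hP]
    rw [hS z hz, show (-1/z + 1) = 1 - 1/z by ring, show 1 - 1/(-1/z) = z + 1 by field_simp; ring]
    have e : (-1/z)^(4*m) = (z^(4*m))⁻¹ := by
      rw [div_pow, Even.neg_one_pow ⟨2*m, by ring⟩, one_div]
    rw [e, show 12*m = 4*m+4*m+4*m by ring, pow_add, pow_add]
    have : z^(4*m) ≠ 0 := pow_ne_zero _ h0
    field_simp
  have hPT : ∀ z : ℂ, 0 < z.im → P (z+1) = P z := by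
    intro z hz
    have h0 := hne z hz
    have h0' : z + 1 ≠ 0 := hne _ (by simpa using hz)
    simp only [hP]
    rw [show z+1+1 = z+2 by ring, h2 z hz]
    have h3 := h2 (-1 - 1/z) (by
      have := him z hz
      rw [neg_div] at this
      rw [sub_eq_add_neg, add_im]; simpa using this)
    have h4 := hS (-1 - 1/z) (by
      have := him z hz
      rw [neg_div] at this
      rw [sub_eq_add_neg, add_im]; simpa using this)
    rw [show -1 / (-1 - 1/z) = 1 - 1/(z+1) by
      have : -1 - 1/z ≠ 0 := by
        rw [show -1 - 1/z = -(z+1)/z by field_simp; ring]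
        exact div_ne_zero (neg_ne_zero.2 h0') h0
      have h5 : -z - 1 ≠ 0 := by rw [show -z - 1 = -(z+1) by ring]; exact neg_ne_zero.2 h0'
      field_simp
      ring, ← h3, show -1 - 1/z + 2 = 1 - 1/z by ring] at h4
    rw [h4]
    have e : (-1 - 1/z)^(4*m) = (z+1)^(4*m) / z^(4*m) := by
      rw [← div_pow, show -1 - 1/z = -((z+1)/z) by field_simp; ring, Even.neg_pow ⟨2*m, by ring⟩]
    rw [e]
    have : z^(4*m) ≠ 0 := pow_ne_zero _ h0
    have : (z+1)^(4*m) ≠ 0 := pow_ne_zero _ h0'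
    field_simp
  have hcS : ∀ τ : ℍ, ((ModularGroup.S • τ : ℍ) : ℂ) = -1/(τ:ℂ) := by
    intro τ
    rw [UpperHalfPlane.modular_S_smul]
    simp [neg_div, inv_neg]
  have hcT : ∀ τ : ℍ, ((ModularGroup.T • τ : ℍ) : ℂ) = (τ:ℂ) + 1 := by
    intro τ
    rw [UpperHalfPlane.modular_T_smul]
    simp [add_comm]
  have key := weight_zero_zero (fun τ => P τ / discriminant τ ^ m) (by
      have e : (fun τ : ℍ => P τ / discriminant τ ^ m) =
        fun τ : ℍ => ((fun τ : ℍ => P τ) τ) / ((CuspForm.discriminant τ)^m) := rfl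
      have h1 : MDifferentiable 𝓘(ℂ) 𝓘(ℂ) (fun τ : ℍ => P τ) := by
        rw [UpperHalfPlane.mdifferentiable_iff]
        refine hPd.congr fun z hz => ?_
        simp [ofComplex_apply_of_im_pos hz]
      have h2 : MDifferentiable 𝓘(ℂ) 𝓘(ℂ) (fun τ : ℍ => discriminant τ ^ m) := by
        have := CuspForm.discriminant.holo'
        rw [UpperHalfPlane.mdifferentiable_iff] at this ⊢
        exact this.pow m
      exact h1.div h2 (fun z => pow_ne_zero _ (discriminant_ne_zero z)))
    (by
      intro τ
      rw [hcS, hPS _ τ.2, disc_S, mul_pow, ← pow_mul]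
      rw [mul_div_mul_left]
      exact pow_ne_zero _ τ.ne_zero)
    (by
      intro τ
      rw [hcT, hPT _ τ.2, disc_T])
    (by
      have h3 := exp_isBigO_discriminant.pow m
      have h4 := hO.trans_isBigO h3
      exact h4.tendsto_div_nhds_zero)
  have hP0 : ∀ z : ℂ, 0 < z.im → P z = 0 := by
    intro z hz
    have := key ⟨z, hz⟩
    rw [div_eq_zero_iff] at this
    rcases this with h | h
    · exact h
    · exact absurd h (pow_ne_zero _ (discriminant_ne_zero _))
  have hopen : IsOpen {z : ℂ | 0 < z.im} := isOpen_upperHalfPlaneSet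
  have hconn : IsPreconnected {z : ℂ | 0 < z.im} := Convex.isPreconnected (convex_halfSpace_im_gt 0)
  have a1 := hd.analyticOnNhd hopen
  have a2 := hd2.analyticOnNhd hopen
  have a3 := hd4.analyticOnNhd hopen
  rcases (a1.mul a2).eq_zero_or_eq_zero_of_mul_eq_zero a3 (fun z hz => hP0 z hz) hconn with h | h
  · rcases a1.eq_zero_or_eq_zero_of_mul_eq_zero a2 h hconn with h | h
    · exact h
    · intro z hz
      have := h (z+1) (by simpa using hz)
      rw [show z+1+1 = z+2 by ring, h2 z hz] at this
      exact this
  · intro z hz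
    have hz1 : 0 < (z+1).im := by simpa using hz
    have hw : 0 < (-1/(z+1)).im := him _ hz1
    have := h (-1/(z+1)) hw
    have h0' : z + 1 ≠ 0 := hne _ hz1
    rw [show 1 - 1/(-1/(z+1)) = z + 2 by field_simp; ring, h2 z hz, div_eq_zero_iff] at this
    rcases this with h | h
    · exact h
    · exact absurd h (pow_ne_zero _ (hne _ hw))

/-- generic theta series -/
noncomputable def gth {ι : Type*} (r : ι → ℝ) (τ : ℂ) : ℂ := ∑' i, cexp (π * I * τ * r i)

theorem norm_gth_term (r : ℝ) (τ : ℂ) : ‖cexp (π * I * τ * r)‖ = Real.exp (-π * τ.im * r) := by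
  rw [Complex.norm_exp]
  congr 1
  simp

theorem gth_summable {ι : Type*} {r : ι → ℝ} (hs : ∀ t : ℝ, 0 < t → Summable fun i => Real.exp (-π * t * r i))
    {τ : ℂ} (hτ : 0 < τ.im) : Summable fun i => cexp (π * I * τ * r i) := by
  apply Summable.of_norm
  simp_rw [norm_gth_term]
  exact hs _ hτ

theorem gth_diff {ι : Type*} {r : ι → ℝ} (h0 : ∀ i, 0 ≤ r i)
    (hs : ∀ t : ℝ, 0 < t → Summable fun i => Real.exp (-π * t * r i)) :
    DifferentiableOn ℂ (gth r) {z | 0 < z.im} := by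
  intro z hz
  have hz' : 0 < z.im := hz
  have hopen : IsOpen {w : ℂ | z.im / 2 < w.im} := isOpen_lt continuous_const Complex.continuous_im
  have : DifferentiableOn ℂ (gth r) {w : ℂ | z.im / 2 < w.im} := by
    unfold gth
    refine differentiableOn_tsum_of_summable_norm (hs (z.im/2) (by linarith)) (fun i => by fun_prop) hopen ?_
    intro i w hw
    rw [norm_gth_term]
    apply Real.exp_le_exp.2
    have hw' : z.im / 2 < w.im := hw
    have := mul_le_mul_of_nonneg_right hw'.le (h0 i)
    nlinarith [Real.pi_pos]
  exact (this.differentiableAt (hopen.mem_nhds (by simp; linarith))).differentiableWithinAt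

theorem gth_asym {ι : Type*} {r : ι → ℝ}
    (hs : ∀ t : ℝ, 0 < t → Summable fun i => Real.exp (-π * t * r i)) (S : Finset ι) (m' : ℝ)
    (h : ∀ i, i ∉ S → m' ≤ r i) :
    (fun τ : ℍ => gth r τ - ∑ i ∈ S, cexp (π * I * τ * r i)) =O[atImInfty]
      (fun τ : ℍ => Real.exp (-π * m' * τ.im)) := by
  refine IsBigO.of_bound (∑' i : {i // i ∉ S}, Real.exp (-π * (r i - m'))) ?_
  have hev : ∀ᶠ τ : ℍ in atImInfty, 1 ≤ τ.im := by
    rw [Filter.Eventually, UpperHalfPlane.atImInfty_mem]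
    exact ⟨1, fun z hz => hz⟩
  filter_upwards [hev] with τ hτ
  have hsum := gth_summable hs τ.2
  have e : gth r τ - ∑ i ∈ S, cexp (π * I * τ * r i) = ∑' i : {i // i ∉ S}, cexp (π * I * τ * r i) := by
    unfold gth
    rw [← hsum.sum_add_tsum_subtype_compl S]
    ring
  have hs1 : Summable fun i : {i // i ∉ S} => Real.exp (-π * (r i - m')) := by
    have := ((hs 1 one_pos).mul_right (Real.exp (π * m'))).subtype {i | i ∉ S}
    refine this.congr fun i => ?_
    simp only [Function.comp]
    rw [← Real.exp_add]; congr 1; ring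
  rw [e, Real.norm_of_nonneg (Real.exp_pos _).le, ← tsum_mul_right]
  refine tsum_of_norm_bounded ?_ (fun i => ?_) (f := fun i : {i // i ∉ S} => cexp (π * I * τ * r i))
    (g := fun i : {i // i ∉ S} => Real.exp (-π * (r i - m')) * Real.exp (-π * m' * τ.im))
  · exact (hs1.mul_right _).hasSum
  · rw [norm_gth_term, ← Real.exp_add]
    apply Real.exp_le_exp.2
    have h1 := h i i.2
    have : 0 ≤ (r i - m') * (τ.im - 1) := mul_nonneg (by linarith) (by linarith)
    have h2 : (τ:ℂ).im = τ.im := rfl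
    rw [h2]
    nlinarith [Real.pi_pos, mul_nonneg Real.pi_pos.le this]

theorem gth_finite {ι : Type*} {r : ι → ℝ}
    (hs : ∀ t : ℝ, 0 < t → Summable fun i => Real.exp (-π * t * r i)) (m : ℝ) :
    {i | r i ≤ m}.Finite := by
  have h1 := (hs 1 one_pos).tendsto_cofinite_zero
  have h2 := h1.eventually (gt_mem_nhds (Real.exp_pos (-π * 1 * m)))
  rw [Filter.Eventually, Filter.mem_cofinite] at h2
  refine h2.subset fun i hi => ?_
  simp only [Set.mem_compl_iff, Set.mem_ofPred_eq, not_lt] at hi ⊢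
  apply Real.exp_le_exp.2
  nlinarith [Real.pi_pos]
noncomputable def th3 (τ : ℂ) : ℂ := gth (fun m : ℤ => (m:ℝ)^2) τ
noncomputable def th2 (τ : ℂ) : ℂ := gth (fun m : ℤ => ((m:ℝ)+1/2)^2) τ
noncomputable def th4 (τ : ℂ) : ℂ := th3 (τ + 1)
/-- automorphy factor of weight one half -/
noncomputable def sfac (τ : ℂ) : ℂ := (-I * τ) ^ (1/2 : ℂ)

theorem summable_sq_shift (u : ℝ) (t : ℝ) (ht : 0 < t) :
    Summable fun m : ℤ => Real.exp (-π * t * ((m:ℝ)+u)^2) := by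
  have := HurwitzKernelBounds.summable_f_int 0 u ht
  refine this.congr fun m => ?_
  simp [HurwitzKernelBounds.f_int]
  ring_nf

theorem summable_sq (t : ℝ) (ht : 0 < t) :
    Summable fun m : ℤ => Real.exp (-π * t * ((m:ℝ))^2) := by
  simpa using summable_sq_shift 0 t ht

theorem th3_eq (τ : ℂ) : th3 τ = jacobiTheta₂ 0 τ := by
  unfold th3 gth jacobiTheta₂ jacobiTheta₂_term
  congr 1; ext m; congr 1; push_cast; ring

theorem th2_eq (τ : ℂ) : th2 τ = cexp (π * I * τ / 4) * jacobiTheta₂ (τ/2) τ := by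
  unfold th2 gth jacobiTheta₂ jacobiTheta₂_term
  rw [← tsum_mul_left]
  congr 1; ext m; rw [← Complex.exp_add]; congr 1; push_cast; ring

theorem cexp_pi_int_even (m : ℤ) (h : Even m) : cexp (π * I * m) = 1 := by
  obtain ⟨k, rfl⟩ := h
  rw [Complex.exp_eq_one_iff]
  exact ⟨k, by push_cast; ring⟩

theorem th4_eq (τ : ℂ) : th4 τ = jacobiTheta₂ (1/2) τ := by
  unfold th4 th3 gth jacobiTheta₂ jacobiTheta₂_term
  congr 1; ext m
  have h : Even (m^2 - m) := by
    have := Int.even_mul_succ_self (m-1)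
    convert this using 1; ring
  have := cexp_pi_int_even _ h
  calc _ = cexp (π * I * ((m^2 - m : ℤ) : ℂ)) * cexp (2 * π * I * m * (1/2) + π * I * m^2 * τ) := by
        rw [← Complex.exp_add]; congr 1; push_cast; ring
    _ = _ := by rw [this, one_mul]

theorem sfac_ne {τ : ℂ} (hτ : 0 < τ.im) : sfac τ ≠ 0 := by
  have : τ ≠ 0 := by rintro rfl; simp at hτ
  unfold sfac
  simp [Complex.cpow_eq_zero_iff, this]

theorem sfac_sq (τ : ℂ) : sfac τ ^ 2 = -I * τ := by
  unfold sfac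
  rw [← Complex.cpow_nat_mul]
  simp

theorem sfac_pow8 (τ : ℂ) : sfac τ ^ 8 = τ^4 := by
  rw [show 8 = 2*4 by rfl, pow_mul, sfac_sq, mul_pow, neg_pow, I_pow_four]
  norm_num

theorem th3_S {τ : ℂ} (hτ : 0 < τ.im) : th3 (-1/τ) = sfac τ * th3 τ := by
  have h := jacobiTheta₂_functional_equation 0 τ
  have := sfac_ne hτ
  rw [th3_eq, th3_eq, h]
  simp only [sfac] at *
  rw [zero_div, show -π * I * 0^2/τ = 0 by simp, Complex.exp_zero, mul_one, ← mul_assoc, mul_one_div_cancel this, one_mul]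

theorem th4_S {τ : ℂ} (hτ : 0 < τ.im) : th4 (-1/τ) = sfac τ * th2 τ := by
  have h := jacobiTheta₂_functional_equation (τ/2) τ
  have := sfac_ne hτ
  have h0 : τ ≠ 0 := by rintro rfl; simp at hτ
  rw [th4_eq, th2_eq, h]
  simp only [sfac] at *
  rw [show τ/2/τ = 1/2 by field_simp, show -π * I * (τ/2)^2/τ = -(π * I * τ/4) by field_simp; ring, Complex.exp_neg]
  have := Complex.exp_ne_zero (π * I * τ/4)
  field_simp

theorem th2_S {τ : ℂ} (hτ : 0 < τ.im) : th2 (-1/τ) = sfac τ * th4 τ := by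
  have h := jacobiTheta₂_functional_equation (1/2) τ
  have := sfac_ne hτ
  have h0 : τ ≠ 0 := by rintro rfl; simp at hτ
  rw [th4_eq, th2_eq, h]
  simp only [sfac] at *
  rw [show 1/2/τ = -(-1/τ/2) by field_simp, jacobiTheta₂_neg_left, show -π * I * (1/2)^2/τ = π * I * (-1/τ)/4 by field_simp; ring]
  field_simp

theorem th3_two (τ : ℂ) : th3 (τ + 2) = th3 τ := by
  rw [th3_eq, th3_eq, jacobiTheta₂_add_right]

theorem th4_one (τ : ℂ) : th4 (τ + 1) = th3 τ := by
  unfold th4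
  rw [show τ + 1 + 1 = τ + 2 by ring, th3_two]

theorem th2_one (τ : ℂ) : th2 (τ + 1) = cexp (π * I / 4) * th2 τ := by
  unfold th2 gth
  rw [← tsum_mul_left]
  congr 1; ext m
  have := cexp_pi_int_even _ (Int.even_mul_succ_self m)
  calc _ = cexp (π * I * ((m * (m + 1) : ℤ) : ℂ)) * (cexp (π * I / 4) * cexp (π * I * τ * ((((m:ℝ)+1/2)^2 : ℝ) : ℂ))) := by
        rw [← Complex.exp_add, ← Complex.exp_add]; congr 1; push_cast; ring
    _ = _ := by rw [this, one_mul]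

theorem th2_one_pow (τ : ℂ) : th2 (τ + 1) ^ 4 = - th2 τ ^ 4 := by
  rw [th2_one, mul_pow, ← Complex.exp_nat_mul, show ((4:ℕ):ℂ) * (π * I / 4) = π * I by push_cast; ring, Complex.exp_pi_mul_I]
  ring

theorem th3_diff : DifferentiableOn ℂ th3 {z | 0 < z.im} :=
  gth_diff (fun _ => by positivity) (fun t ht => summable_sq t ht)
theorem th2_diff : DifferentiableOn ℂ th2 {z | 0 < z.im} :=
  gth_diff (fun _ => by positivity) (fun t ht => summable_sq_shift (1/2) t ht)
theorem th4_diff : DifferentiableOn ℂ th4 {z | 0 < z.im} :=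
  th3_diff.comp (by fun_prop) (fun z hz => by simpa using hz)

noncomputable def qf (τ : ℍ) : ℂ := cexp (π * I * τ)

theorem norm_qf (τ : ℍ) : ‖qf τ‖ = Real.exp (-π * τ.im) := by
  have := norm_gth_term 1 τ
  simpa [qf] using this

theorem tendsto_im_atTop : Tendsto (fun τ : ℍ => τ.im) atImInfty atTop := tendsto_comap

theorem tendsto_exp_im {c : ℝ} (hc : 0 < c) :
    Tendsto (fun τ : ℍ => Real.exp (-c * τ.im)) atImInfty (𝓝 0) := by
  apply Real.tendsto_exp_atBot.comp
  exact (tendsto_im_atTop).const_mul_atTop_of_neg (by linarith)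

theorem qf_tendsto : Tendsto qf atImInfty (𝓝 0) := by
  rw [tendsto_zero_iff_norm_tendsto_zero]
  simp_rw [norm_qf]
  exact tendsto_exp_im Real.pi_pos

/-- first order jet in `q` at infinity -/
def Jet (f : ℍ → ℂ) (a b : ℂ) : Prop :=
  (fun τ : ℍ => f τ - a - b * qf τ) =O[atImInfty] (fun τ => qf τ ^ 2)

theorem qf_isBigO_one : qf =O[atImInfty] (fun _ => (1:ℂ)) := qf_tendsto.isBigO_one ℂ

theorem Jet.tendsto {f : ℍ → ℂ} {a b : ℂ} (h : Jet f a b) : Tendsto f atImInfty (𝓝 a) := by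
  have h1 : Tendsto (fun τ => qf τ ^ 2) atImInfty (𝓝 0) := by simpa using qf_tendsto.pow 2
  have h2 := h.trans_tendsto h1
  have h3 := (h2.add_const a).add (qf_tendsto.const_mul b)
  simp only [zero_add, mul_zero, add_zero] at h3
  refine h3.congr fun τ => ?_
  ring

theorem Jet.bdd {f : ℍ → ℂ} {a b : ℂ} (h : Jet f a b) : f =O[atImInfty] (fun _ => (1:ℂ)) :=
  h.tendsto.isBigO_one ℂ

theorem Jet.mul {f g : ℍ → ℂ} {a b c d : ℂ} (hf : Jet f a b) (hg : Jet g c d) :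
    Jet (fun τ => f τ * g τ) (a * c) (a * d + b * c) := by
  have h1 : (fun τ : ℍ => (f τ - a - b * qf τ) * g τ) =O[atImInfty] (fun τ => qf τ ^ 2) := by
    simpa using IsBigO.mul (show (fun τ : ℍ => f τ - a - b * qf τ) =O[atImInfty] (fun τ => qf τ ^ 2) from hf) hg.bdd
  have h2 : (fun τ : ℍ => (a + b * qf τ) * (g τ - c - d * qf τ)) =O[atImInfty] (fun τ => qf τ ^ 2) := by
    have : (fun τ : ℍ => a + b * qf τ) =O[atImInfty] (fun _ => (1:ℂ)) :=
      ((tendsto_const_nhds (x := a)).add (qf_tendsto.const_mul b)).isBigO_one ℂ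
    simpa using this.mul hg
  have h3 : (fun τ : ℍ => b * d * qf τ ^ 2) =O[atImInfty] (fun τ => qf τ ^ 2) :=
    (isBigO_refl _ _).const_mul_left _
  refine ((h1.add h2).add h3).congr_left fun τ => ?_
  ring

theorem Jet.add {f g : ℍ → ℂ} {a b c d : ℂ} (hf : Jet f a b) (hg : Jet g c d) :
    Jet (fun τ => f τ + g τ) (a + c) (b + d) := by
  refine (IsBigO.add hf hg).congr_left fun τ => ?_
  ring

theorem Jet.sub {f g : ℍ → ℂ} {a b c d : ℂ} (hf : Jet f a b) (hg : Jet g c d) :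
    Jet (fun τ => f τ - g τ) (a - c) (b - d) := by
  refine (IsBigO.sub hf hg).congr_left fun τ => ?_
  ring

theorem Jet.const (a : ℂ) : Jet (fun _ => a) a 0 := by
  simp [Jet, isBigO_zero]

theorem Jet.q : Jet qf 0 1 := by
  simp [Jet, isBigO_zero]

theorem Jet.pow {f : ℍ → ℂ} {b : ℂ} (hf : Jet f 1 b) (k : ℕ) :
    Jet (fun τ => f τ ^ k) 1 (k * b) := by
  induction k with
  | zero => simpa using Jet.const 1
  | succ k ih =>
    have := ih.mul hf
    simp only [pow_succ]
    convert this using 1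
    · ring
    · push_cast; ring

theorem Jet.pow0 {f : ℍ → ℂ} {a : ℂ} (hf : Jet f a 0) (k : ℕ) :
    Jet (fun τ => f τ ^ k) (a ^ k) 0 := by
  induction k with
  | zero => simpa using Jet.const 1
  | succ k ih =>
    have := ih.mul hf
    simp only [pow_succ]
    convert this using 1
    ring

theorem Jet.of_norm {f : ℍ → ℂ} {a b : ℂ}
    (h : (fun τ : ℍ => f τ - a - b * qf τ) =O[atImInfty] (fun τ : ℍ => Real.exp (-π * 2 * τ.im))) :
    Jet f a b := by
  refine h.trans (IsBigO.of_bound 1 (Eventually.of_forall fun τ => ?_))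
  rw [norm_pow, norm_qf, ← Real.exp_nat_mul, Real.norm_of_nonneg (Real.exp_pos _).le, one_mul]
  apply Real.exp_le_exp.2
  push_cast; linarith

theorem th3_jet : Jet (fun τ => th3 τ) 1 2 := by
  apply Jet.of_norm
  have := gth_asym (r := fun m : ℤ => (m:ℝ)^2) (fun t ht => summable_sq t ht) {0, 1, -1} 2 (by
    intro i hi
    simp only [Finset.mem_insert, Finset.mem_singleton, not_or] at hi
    have : 2 ≤ i^2 := by
      rcases lt_or_ge i 0 with h | h
      · have : i ≤ -2 := by lia
        nlinarith
      · have : 2 ≤ i := by lia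
        nlinarith
    exact_mod_cast this)
  refine this.congr_left fun τ => ?_
  simp [th3, qf]
  ring

theorem tendsto_vadd : Tendsto (fun τ : ℍ => (1:ℝ) +ᵥ τ) atImInfty atImInfty := by
  unfold atImInfty
  rw [tendsto_comap_iff]
  refine tendsto_comap.congr fun τ => ?_
  simp

theorem qf_vadd (τ : ℍ) : qf ((1:ℝ) +ᵥ τ) = - qf τ := by
  unfold qf
  rw [UpperHalfPlane.coe_vadd, mul_add, Complex.exp_add]
  simp [Complex.exp_pi_mul_I]

theorem th4_jet : Jet (fun τ => th4 τ) 1 (-2) := by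
  have := th3_jet
  have h := IsBigO.comp_tendsto this tendsto_vadd
  refine (h.congr_left fun τ => ?_).congr_right fun τ => ?_
  · simp only [Function.comp]
    rw [qf_vadd, UpperHalfPlane.coe_vadd, th4, add_comm]
    simp
  · simp only [Function.comp]
    rw [qf_vadd]; ring

/-- normalised theta two -/
noncomputable def psi (τ : ℂ) : ℂ := th2 τ * cexp (-(π * I * τ / 4))

theorem th2_psi (τ : ℂ) : th2 τ = psi τ * cexp (π * I * τ / 4) := by
  rw [psi, mul_assoc, ← Complex.exp_add]; simp

theorem psi_jet : Jet (fun τ => psi τ) 2 0 := by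
  apply Jet.of_norm
  have := gth_asym (r := fun m : ℤ => ((m:ℝ)+1/2)^2) (fun t ht => summable_sq_shift (1/2) t ht) {0, -1} (9/4) (by
    intro i hi
    simp only [Finset.mem_insert, Finset.mem_singleton, not_or] at hi
    rcases lt_or_ge i 0 with h | h
    · have : i ≤ -2 := by lia
      have : (i:ℝ) ≤ -2 := by exact_mod_cast this
      nlinarith
    · have : 1 ≤ i := by lia
      have : (1:ℝ) ≤ i := by exact_mod_cast this
      nlinarith)
  have h2 : (fun τ : ℍ => cexp (-(π * I * τ / 4))) =O[atImInfty] (fun τ : ℍ => Real.exp (π * (1/4) * τ.im)) := by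
    refine IsBigO.of_bound 1 (Eventually.of_forall fun τ => ?_)
    rw [show -(π * I * (τ:ℂ) / 4) = π * I * τ * ((-1/4 : ℝ) : ℂ) by push_cast; ring, norm_gth_term, Real.norm_of_nonneg (Real.exp_pos _).le, one_mul]
    apply Real.exp_le_exp.2
    rw [coe_im]; linarith
  have h3 := this.mul h2
  refine (h3.congr_left fun τ => ?_).congr_right fun τ => ?_
  · rw [sub_mul, psi, th2]
    rw [Finset.sum_insert (by simp), Finset.sum_singleton]
    rw [show (π * I * (τ:ℂ) * ((((0:ℤ):ℝ) + 1/2)^2 : ℝ)) = π * I * τ / 4 by push_cast; ring,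
      show (π * I * (τ:ℂ) * ((((-1:ℤ):ℝ) + 1/2)^2 : ℝ)) = π * I * τ / 4 by push_cast; ring, add_mul, ← Complex.exp_add]
    simp
    ring
  · rw [← Real.exp_add]; congr 1; ring

theorem th2_pow_jet : Jet (fun τ => th2 τ ^ 4) 0 16 := by
  have := (psi_jet.pow0 4).mul Jet.q
  have e : (fun τ : ℍ => th2 τ ^ 4) = fun τ : ℍ => psi τ ^ 4 * qf τ := by
    ext τ
    rw [th2_psi, mul_pow, ← Complex.exp_nat_mul, qf]
    congr 2
    push_cast; ring
  rw [e]
  convert this using 1 <;> norm_num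

theorem im_neg_inv {z : ℂ} (hz : 0 < z.im) : 0 < (-1/z).im := by
  have := UpperHalfPlane.im_inv_neg_coe_pos ⟨z, hz⟩
  rw [neg_div, one_div]
  simpa [inv_neg] using this

theorem partE (n : ℕ) (A Sh : ℂ → ℂ) (N : ℂ)
    (hAd : DifferentiableOn ℂ A {z | 0 < z.im})
    (hA2 : ∀ z : ℂ, 0 < z.im → A (z + 2) = A z)
    (hAS : ∀ z : ℂ, 0 < z.im → A (-1/z) = sfac z ^ n * A z)
    (hA1 : ∀ z : ℂ, 0 < z.im → A (1 - 1/z) = sfac z ^ n * Sh z)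
    (hA0 : (fun τ : ℍ => A τ - 1) =O[atImInfty] fun τ : ℍ => Real.exp (-π * 2 * τ.im))
    (hSh : Tendsto (fun τ : ℍ => Sh τ * cexp (-(π * I * τ * (n - 8) / 4))) atImInfty (𝓝 N)) :
    N * 2 ^ 8 = (n / 8) * 2 ^ n := by
  set F : ℂ → ℂ := fun z => A z * th3 z ^ 8 - th3 z ^ (n + 8) + n / 8 * th3 z ^ n * th2 z ^ 4 * th4 z ^ 4 with hF
  set K : ℂ → ℂ := fun z => (Sh z * cexp (-(π * I * z * (n - 8) / 4))) * psi z ^ 8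
    - psi z ^ (n + 8) * cexp (π * I * z) ^ 2 - n / 8 * psi z ^ n * th4 z ^ 4 * th3 z ^ 4 with hK
  have hFd : DifferentiableOn ℂ F {z | 0 < z.im} := by
    have h2 := th2_diff
    have h3 := th3_diff
    have h4 := th4_diff
    simp only [hF]
    fun_prop
  have hF2 : ∀ z : ℂ, 0 < z.im → F (z + 2) = F z := by
    intro z hz
    simp only [hF]
    rw [hA2 z hz, th3_two, show th2 (z+2) ^ 4 = th2 z ^ 4 by
      rw [show z + 2 = z + 1 + 1 by ring, th2_one_pow, th2_one_pow, neg_neg],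
      show th4 (z+2) = th4 z by unfold th4; rw [show z + 2 + 1 = z + 1 + 2 by ring, th3_two]]
  have hFS : ∀ z : ℂ, 0 < z.im → F (-1/z) = sfac z ^ (n + 8) * F z := by
    intro z hz
    simp only [hF]
    rw [hAS z hz, th3_S hz, th2_S hz, th4_S hz]
    ring
  have hF1 : ∀ z : ℂ, 0 < z.im → F (1 - 1/z) = sfac z ^ (n + 8) * (cexp (π * I * z * n / 4) * K z) := by
    intro z hz
    have e : 1 - 1/z = -1/z + 1 := by ring
    have e3 : th3 (1 - 1/z) = sfac z * th2 z := by
      rw [← th4_S hz, th4, e]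
    have e2 : th2 (1 - 1/z) ^ 4 = - (sfac z * th4 z) ^ 4 := by
      rw [e, th2_one_pow, th2_S hz]
    have e4 : th4 (1 - 1/z) = sfac z * th3 z := by
      rw [e, th4_one, th3_S hz]
    have k1 : th2 z = psi z * cexp (π * I * z / 4) := th2_psi z
    have c1 : cexp (π * I * z * n / 4) = cexp (π * I * z / 4) ^ n := by
      rw [← Complex.exp_nat_mul]; congr 1; ring
    have c2 : cexp (π * I * z) ^ 2 = cexp (π * I * z / 4) ^ 8 := by
      rw [← Complex.exp_nat_mul, ← Complex.exp_nat_mul]; congr 1; push_cast; ring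
    have c3 : cexp (π * I * z / 4) ^ n * cexp (-(π * I * z * (n - 8) / 4)) = cexp (π * I * z / 4) ^ 8 := by
      rw [← Complex.exp_nat_mul, ← Complex.exp_nat_mul, ← Complex.exp_add]; congr 1; push_cast; ring
    simp only [hF, hK]
    rw [hA1 z hz, e3, e2, e4, k1, c1, c2]
    generalize cexp (π * I * z / 4) = x at *
    generalize cexp (-(π * I * z * (n - 8) / 4)) = y at *
    linear_combination (-(sfac z ^ (n+8) * Sh z * psi z ^ 8)) * c3
  have hFj : (fun τ : ℍ => F τ) =O[atImInfty] (fun τ => qf τ ^ 2) := by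
    have hAj : Jet (fun τ => A τ) 1 0 := Jet.of_norm (by simpa using hA0)
    have h := ((hAj.mul (th3_jet.pow 8)).sub (th3_jet.pow (n + 8))).add
      ((((Jet.const (n / 8 : ℂ)).mul (th3_jet.pow n)).mul th2_pow_jet).mul (th4_jet.pow 4))
    unfold Jet at h
    refine h.congr_left fun τ => ?_
    simp only [hF]
    push_cast
    ring
  have hFj1 : (fun τ : ℍ => F (τ + 1)) =O[atImInfty] (fun τ => qf τ ^ 2) := by
    have h := IsBigO.comp_tendsto hFj tendsto_vadd
    refine (h.congr_left fun τ => ?_).congr_right fun τ => ?_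
    · simp only [Function.comp]
      rw [UpperHalfPlane.coe_vadd, add_comm]
      simp
    · simp only [Function.comp]
      rw [qf_vadd]; ring
  have hKt : Tendsto (fun τ : ℍ => K τ) atImInfty (𝓝 (N * 2 ^ 8 - 2 ^ (n+8) * 0 ^ 2 - n / 8 * 2 ^ n * 1 ^ 4 * 1 ^ 4)) := by
    have p := psi_jet.tendsto
    refine ((hSh.mul (p.pow 8)).sub ((p.pow (n+8)).mul (qf_tendsto.pow 2))).sub
      (((tendsto_const_nhds.mul (p.pow n)).mul (th4_jet.tendsto.pow 4)).mul (th3_jet.tendsto.pow 4))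
  have hO : (fun τ : ℍ => F τ ^ 8 * F (τ+1) ^ 8 * (F (1-1/τ) ^ 8 / (τ:ℂ)^(4*(n+8)))) =o[atImInfty]
      (fun τ : ℍ => Real.exp (-2*π*τ.im)^(n+8)) := by
    have h1 := ((hFj.pow 8).mul (hFj1.pow 8)).mul ((((isBigO_refl (fun τ : ℍ => cexp (π * I * τ * n / 4)) atImInfty)).mul (hKt.isBigO_one ℂ)).pow 8)
    have h2 : (fun τ : ℍ => (qf τ ^ 2)^8 * (qf τ ^ 2)^8 * (cexp (π * I * τ * n / 4) * 1)^8) =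
        fun τ : ℍ => qf τ ^ (2*(n+8)) * qf τ ^ 16 := by
      ext τ
      have : cexp (π * I * τ * n / 4) ^ 8 = qf τ ^ (2*n) := by
        rw [qf, ← Complex.exp_nat_mul, ← Complex.exp_nat_mul]; congr 1; push_cast; ring
      rw [mul_one, this]
      ring
    rw [h2] at h1
    have h3 : (fun τ : ℍ => qf τ ^ (2*(n+8)) * qf τ ^ 16) =o[atImInfty] (fun τ : ℍ => Real.exp (-2*π*τ.im)^(n+8) * (1:ℝ)) := by
      refine IsBigO.mul_isLittleO ?_ ?_
      · refine IsBigO.of_bound 1 (Eventually.of_forall fun τ => ?_)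
        rw [norm_pow, norm_qf, ← Real.exp_nat_mul, ← Real.exp_nat_mul, Real.norm_of_nonneg (Real.exp_pos _).le, one_mul]
        apply Real.exp_le_exp.2
        push_cast; linarith
      · rw [isLittleO_one_iff]
        simpa using qf_tendsto.pow 16
    have h4 := h1.trans_isLittleO h3
    simp only [mul_one] at h4
    refine h4.congr_left fun τ => ?_
    congr 1
    rw [hF1 _ τ.2, mul_pow (sfac _ ^ (n+8)), ← pow_mul, mul_comm (n+8) 8, pow_mul, sfac_pow8, ← pow_mul]
    rw [mul_div_cancel_left₀]
    exact pow_ne_zero _ τ.ne_zero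
  have hG := partB (fun z => F z ^ 8) (n + 8) (hFd.pow 8) (fun z hz => by simp only [hF2 z hz])
    (fun z hz => by
      simp only [hFS z hz]
      rw [mul_pow, ← pow_mul, mul_comm (n+8) 8, pow_mul, sfac_pow8, ← pow_mul]) hO
  have hK0 : ∀ τ : ℍ, K τ = 0 := by
    intro τ
    have h1 : 0 < (1 - 1/(τ:ℂ)).im := by
      have := im_neg_inv τ.2
      rw [neg_div] at this
      rw [sub_eq_add_neg, add_im]; simpa using this
    have h2 : F (1 - 1/(τ:ℂ)) = 0 := by simpa using hG _ h1
    rw [hF1 _ τ.2] at h2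
    have h3 : sfac τ ^ (n+8) ≠ 0 := pow_ne_zero _ (sfac_ne τ.2)
    have h4 := Complex.exp_ne_zero (π * I * τ * n / 4)
    simpa [h3, h4] using h2
  have : Tendsto (fun τ : ℍ => K τ) atImInfty (𝓝 0) := by
    simp_rw [hK0]; exact tendsto_const_nhds
  have := tendsto_nhds_unique hKt this
  linear_combination this

open MeasureTheory Set Function in
theorem poisson_pi {ι : Type*} [Fintype ι] (f : (ι → ℝ) → ℂ) (hf : Continuous f)
    (hfi : Integrable f)
    (hb : ∀ R : ℝ, ∃ g : (ι → ℤ) → ℝ, Summable g ∧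
      ∀ (k : ι → ℤ) (x : ι → ℝ), ‖x‖ ≤ R → ‖f (x + fun i => (k i : ℝ))‖ ≤ g k)
    (hc : Summable fun k : ι → ℤ => ∫ x : ι → ℝ, cexp (-(2 * π * I * ∑ i, (k i : ℂ) * x i)) * f x) :
    HasSum (fun k : ι → ℤ => ∫ x : ι → ℝ, cexp (-(2 * π * I * ∑ i, (k i : ℂ) * x i)) * f x)
      (∑' k : ι → ℤ, f (fun i => (k i : ℝ))) := by
  classical
  set P : (ι → ℝ) → ℂ := fun x => ∑' k : ι → ℤ, f (x + fun i => (k i : ℝ)) with hP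
  have hPc : Continuous P := by
    rw [continuous_iff_continuousAt]
    intro x
    obtain ⟨g, hg, hgb⟩ := hb (‖x‖ + 1)
    have : ContinuousOn P (Metric.ball x 1) := by
      refine continuousOn_tsum (fun k => by fun_prop) hg (fun k y hy => hgb k y ?_)
      have : ‖y - x‖ < 1 := by simpa [dist_eq_norm] using hy
      linarith [norm_le_norm_add_norm_sub' y x]
    exact this.continuousAt (Metric.ball_mem_nhds x one_pos)
  have hPper : ∀ (x : ι → ℝ) (m : ι → ℤ), P (x + fun i => (m i : ℝ)) = P x := by
    intro x m
    simp only [hP]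
    rw [← (Equiv.addLeft m).tsum_eq (fun k : ι → ℤ => f (x + fun i => (k i : ℝ)))]
    refine tsum_congr fun k => ?_
    congr 1
    ext i
    simp [add_assoc]
  let q : (ι → ℝ) → UnitAddTorus ι := fun x i => (x i : UnitAddCircle)
  have hq : IsOpenQuotientMap q :=
    IsOpenQuotientMap.piMap (fun i : ι => (QuotientAddGroup.isOpenQuotientMap_mk :
      IsOpenQuotientMap (QuotientAddGroup.mk : ℝ → UnitAddCircle)))
  have hinv : ∀ x y, q x = q y → P x = P y := by
    intro x y hxy
    have : ∀ i, ∃ m : ℤ, y i = x i + m := by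
      intro i
      have := congrFun hxy i
      simp only [q] at this
      rw [QuotientAddGroup.eq_iff_sub_mem, AddSubgroup.mem_zmultiples_iff] at this
      obtain ⟨m, hm⟩ := this
      refine ⟨-m, ?_⟩
      simp at hm
      push_cast
      linarith
    choose m hm using this
    rw [show y = x + fun i => (m i : ℝ) from funext hm, hPper]
  let G : UnitAddTorus ι → ℂ := fun t => P (Function.surjInv hq.surjective t)
  have hGq : ∀ x, G (q x) = P x := fun x => hinv _ _ (Function.surjInv_eq hq.surjective _)
  have hGc : Continuous G := by
    rw [hq.isQuotientMap.continuous_iff]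
    exact hPc.congr fun x => (hGq x).symm
  let G' : C(UnitAddTorus ι, ℂ) := ⟨G, hGc⟩
  have hmF : ∀ (k : ι → ℤ) (x : ι → ℝ), UnitAddTorus.mFourier (-k) (fun i => (x i : UnitAddCircle)) =
      cexp (-(2 * π * I * ∑ i, (k i : ℂ) * x i)) := by
    intro k x
    simp only [UnitAddTorus.mFourier, ContinuousMap.coe_mk, fourier_coe_apply]
    rw [← Complex.exp_sum, Finset.mul_sum, ← Finset.sum_neg_distrib]
    congr 1
    refine Finset.sum_congr rfl fun i _ => ?_
    simp; ring
  have hcoef : ∀ k, UnitAddTorus.mFourierCoeff G' k =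
      ∫ x : ι → ℝ, cexp (-(2 * π * I * ∑ i, (k i : ℂ) * x i)) * f x := by
    intro k
    rw [UnitAddTorus.mFourierCoeff_eq_integral _ _ 0]
    set e : (ι → ℝ) → ℂ := fun x => cexp (-(2 * π * I * ∑ i, (k i : ℂ) * x i)) with he
    have hec : Continuous e := by simp only [he]; fun_prop
    have hen : ∀ x, ‖e x‖ = 1 := by
      intro x
      simp only [he]
      rw [show -(2 * π * I * ∑ i, (k i : ℂ) * x i) = ((-(2 * π * ∑ i, (k i : ℝ) * x i) : ℝ) : ℂ) * I by
        push_cast; ring]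
      exact Complex.norm_exp_ofReal_mul_I _
    have heper : ∀ (x : ι → ℝ) (m : ι → ℤ), e (x + fun i => (m i : ℝ)) = e x := by
      intro x m
      simp only [he]
      rw [← hmF, ← hmF]
      congr 1
      ext i
      simp
    have hInt : Integrable (fun x => e x * f x) := by
      refine hfi.bdd_mul (c := 1) hec.aestronglyMeasurable (Eventually.of_forall fun x => (hen x).le)
    let S : (ι → ℤ) → Set (ι → ℝ) := fun m => {x | ∀ i, x i ∈ Ioc (m i : ℝ) (m i + 1)}
    have hSm : ∀ m, MeasurableSet (S m) := fun m => MeasurableSet.univ_pi' (fun i => measurableSet_Ioc)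
    have hceil : ∀ (x : ι → ℝ) (m : ι → ℤ), x ∈ S m ↔ ∀ i, ⌈x i⌉ = m i + 1 := by
      intro x m
      simp only [S, Set.mem_ofPred_eq]
      refine forall_congr' fun i => ?_
      rw [Int.ceil_eq_iff]
      push_cast
      simp
    have hSd : Pairwise (Disjoint on S) := by
      intro m m' hmm
      rw [Function.onFun, Set.disjoint_left]
      intro x hx hx'
      rw [hceil] at hx hx'
      apply hmm
      ext i
      have := hx i
      have := hx' i
      omega
    have hSu : (⋃ m, S m) = univ := by
      rw [eq_univ_iff_forall]
      intro x
      rw [mem_iUnion]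
      refine ⟨fun i => ⌈x i⌉ - 1, ?_⟩
      rw [hceil]
      intro i; ring
    have h1 := hasSum_integral_iUnion hSm hSd (μ := volume) (f := fun x => e x * f x) hInt.integrableOn
    rw [hSu, Measure.restrict_univ] at h1
    have hS0 : {x : ι → ℝ | ∀ i, x i ∈ Ioc ((0 : ι → ℝ) i) ((0 : ι → ℝ) i + 1)} = S 0 := by
      simp [S]
    rw [hS0]
    have htr : ∀ m, ∫ x in S m, e x * f x = ∫ x in S 0, e x * f (x + fun i => (m i : ℝ)) := by
      intro m
      have hmp := measurePreserving_add_right (volume : Measure (ι → ℝ)) (fun i => (m i : ℝ))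
      have := hmp.setIntegral_preimage_emb (measurableEmbedding_addRight _) (fun x => e x * f x) (S m)
      rw [← this]
      have hpre : (fun x : ι → ℝ => x + fun i => (m i : ℝ)) ⁻¹' S m = S 0 := by
        ext x
        simp only [S, Set.mem_preimage, Set.mem_ofPred_eq, Pi.add_apply, Pi.zero_apply, Int.cast_zero,
          Set.mem_Ioc]
        refine forall_congr' fun i => ?_
        constructor
        · rintro ⟨h1, h2⟩
          constructor <;> linarith
        · rintro ⟨h1, h2⟩
          constructor <;> linarith
      rw [hpre]
      simp only [heper]
    obtain ⟨g, hg, hgb⟩ := hb 1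
    have hn1 : ∀ x ∈ S 0, ‖x‖ ≤ 1 := by
      intro x hx
      rw [pi_norm_le_iff_of_nonneg zero_le_one]
      intro i
      have := hx i
      simp at this
      rw [Real.norm_of_nonneg this.1.le]
      exact this.2
    have hfin : volume (S 0) ≠ ⊤ := by
      refine ne_of_lt (lt_of_le_of_lt (measure_mono (t := Metric.closedBall 0 1) ?_)
        measure_closedBall_lt_top)
      intro x hx
      simpa using hn1 x hx
    have hIi : ∀ m : ι → ℤ, Integrable (fun x => e x * f (x + fun i => (m i : ℝ))) (volume.restrict (S 0)) := by
      intro m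
      refine Measure.integrableOn_of_bounded (M := g m) hfin (by fun_prop) ?_
      rw [ae_restrict_iff' (hSm 0)]
      refine Eventually.of_forall fun x hx => ?_
      rw [norm_mul, hen, one_mul]
      exact hgb m x (hn1 x hx)
    have h2 := hasSum_integral_of_summable_integral_norm (μ := volume.restrict (S 0))
      (F := fun (m : ι → ℤ) x => e x * f (x + fun i => (m i : ℝ))) hIi (by
        refine Summable.of_nonneg_of_le (fun m => integral_nonneg fun _ => norm_nonneg _) (fun m => ?_)
          (hg.mul_right (volume.real (S 0)))
        have := setIntegral_mono_on (μ := volume) (s := S 0) (hIi m).norm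
          (integrableOn_const (C := g m) hfin) (hSm 0) (fun x hx => by
            rw [norm_mul, hen, one_mul]
            exact hgb m x (hn1 x hx))
        refine this.trans (le_of_eq ?_)
        simp [mul_comm])
    simp_rw [htr] at h1
    rw [h1.unique h2]
    refine setIntegral_congr_fun (hSm 0) fun x _ => ?_
    simp only [smul_eq_mul]
    rw [hmF, tsum_mul_left]
    congr 1
    exact hGq x
  have hsum : Summable (UnitAddTorus.mFourierCoeff G') := by
    refine hc.congr fun k => (hcoef k).symm
  have := UnitAddTorus.hasSum_mFourier_series_apply_of_summable hsum (q 0)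
  have h3 : G' (q 0) = ∑' k : ι → ℤ, f (fun i => (k i : ℝ)) := by
    change G (q 0) = _
    rw [hGq]; simp [hP]
  rw [h3] at this
  refine this.congr_fun fun k => ?_
  rw [hcoef]
  simp [q, UnitAddTorus.mFourier]


theorem lat_summable {n : ℕ} (L : Submodule ℤ (EuclideanSpace ℝ (Fin n))) [DiscreteTopology L]
    (u : EuclideanSpace ℝ (Fin n)) (t : ℝ) (ht : 0 < t) :
    Summable fun v : L => Real.exp (-π * t * ‖(v : EuclideanSpace ℝ (Fin n)) + u‖ ^ 2) := by
  set k := Module.finrank ℤ L + 1 with hk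
  have h := ZLattice.summable_norm_sub_inv_pow L (2 * k) (by omega) (-u)
  refine Summable.of_norm_bounded_eventually (h.mul_left (k.factorial / (π * t) ^ k : ℝ)) ?_
  rw [Filter.Eventually, Filter.mem_cofinite]
  refine Set.Subsingleton.finite ?_
  have key : ∀ v : L, (v : EuclideanSpace ℝ (Fin n)) + u ≠ 0 →
      ‖Real.exp (-π * t * ‖(v : EuclideanSpace ℝ (Fin n)) + u‖ ^ 2)‖ ≤
      (k.factorial / (π * t) ^ k : ℝ) * ‖(v : EuclideanSpace ℝ (Fin n)) - (-u)‖⁻¹ ^ (2 * k) := by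
    intro v hv
    have hs : 0 < ‖(v : EuclideanSpace ℝ (Fin n)) + u‖ := norm_pos_iff.2 hv
    rw [sub_neg_eq_add]
    generalize ‖(v : EuclideanSpace ℝ (Fin n)) + u‖ = s at hs
    rw [Real.norm_of_nonneg (Real.exp_pos _).le]
    have hx : 0 < π * t * s ^ 2 := by positivity
    have h1 := Real.pow_div_factorial_le_exp (π * t * s ^ 2) hx.le k
    rw [show -π * t * s ^ 2 = - (π * t * s ^ 2) by ring, Real.exp_neg]
    have h2 : (k.factorial / (π * t) ^ k : ℝ) * s⁻¹ ^ (2 * k) = ((π * t * s ^ 2) ^ k / k.factorial)⁻¹ := by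
      rw [mul_pow _ (s^2), ← pow_mul, inv_div, inv_pow]
      field_simp
    rw [h2]
    exact inv_anti₀ (by positivity) h1
  intro v hv v' hv'
  have e1 : (v : EuclideanSpace ℝ (Fin n)) + u = 0 := by
    by_contra hc
    exact hv (key v hc)
  have e2 : (v' : EuclideanSpace ℝ (Fin n)) + u = 0 := by
    by_contra hc
    exact hv' (key v' hc)
  exact Subtype.ext (add_right_cancel (e1.trans e2.symm))

open scoped RealInnerProductSpace in
theorem lat_dual {n : ℕ} (L : Submodule ℤ (EuclideanSpace ℝ (Fin n))) (hL : IsUnimodularLattice n L)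
    [DiscreteTopology L] [IsZLattice ℝ L]
    {ι : Type*} [Fintype ι] (b : Module.Basis ι ℤ L) :
    ∃ D : (ι → ℤ) ≃ L, ∀ k i, ⟪(D k : EuclideanSpace ℝ (Fin n)), (b i : EuclideanSpace ℝ (Fin n))⟫ = (k i : ℝ) := by
  have h1 : ∀ (v : L) (i : ι), ∃ k : ℤ, ⟪(v : EuclideanSpace ℝ (Fin n)), (b i : EuclideanSpace ℝ (Fin n))⟫ = (k : ℝ) :=
    fun v i => (hL.2.2 v).1 v.2 _ (b i).2
  choose φ hφ using h1
  let B := b.ofZLatticeBasis ℝ L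
  have hB : ∀ i, B i = (b i : EuclideanSpace ℝ (Fin n)) := b.ofZLatticeBasis_apply ℝ L
  have hinj : Function.Injective φ := by
    intro v v' h
    apply Subtype.ext
    refine InnerProductSpace.ext_inner_right_basis (𝕜 := ℝ) B fun i => ?_
    rw [hB, hφ, hφ, h]
  have hsurj : Function.Surjective φ := by
    intro k
    let f : EuclideanSpace ℝ (Fin n) →L[ℝ] ℝ := LinearMap.toContinuousLinearMap (B.constr ℝ fun i => (k i : ℝ))
    let v := (InnerProductSpace.toDual ℝ (EuclideanSpace ℝ (Fin n))).symm f
    have hv : ∀ x, ⟪v, x⟫ = f x := fun x => InnerProductSpace.toDual_symm_apply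
    have hvi : ∀ i, ⟪v, (b i : EuclideanSpace ℝ (Fin n))⟫ = k i := by
      intro i
      rw [hv, ← hB]
      exact B.constr_basis ℝ _ i
    have hvL : v ∈ L := by
      rw [hL.2.2]
      intro y hy
      refine ⟨∑ i, b.repr ⟨y, hy⟩ i * k i, ?_⟩
      have : y = ∑ i, b.repr ⟨y, hy⟩ i • (b i : EuclideanSpace ℝ (Fin n)) := by
        have := congrArg Subtype.val (b.sum_repr ⟨y, hy⟩)
        rw [AddSubmonoidClass.coe_finsetSum] at this
        exact this.symm
      conv_lhs => rw [this]
      rw [inner_sum]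
      push_cast
      refine Finset.sum_congr rfl fun i _ => ?_
      rw [← Int.cast_smul_eq_zsmul ℝ, inner_smul_right, hvi]
    refine ⟨⟨v, hvL⟩, ?_⟩
    ext i
    have := hφ ⟨v, hvL⟩ i
    rw [hvi] at this
    exact_mod_cast this.symm
  let D := (Equiv.ofBijective φ ⟨hinj, hsurj⟩).symm
  refine ⟨D, fun k i => ?_⟩
  rw [hφ]
  have : φ (D k) = k := (Equiv.ofBijective φ ⟨hinj, hsurj⟩).apply_symm_apply k
  rw [this]

open scoped RealInnerProductSpace in
theorem lat_char {n : ℕ} (L : Submodule ℤ (EuclideanSpace ℝ (Fin n))) (hL : IsUnimodularLattice n L)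
    [DiscreteTopology L] [IsZLattice ℝ L] : ∃ w, IsCharacteristic n L w := by
  have := ZLattice.module_finite ℝ L
  have := ZLattice.module_free ℝ L
  let b := Module.Free.chooseBasis ℤ L
  obtain ⟨D, hD⟩ := lat_dual L hL b
  have hInt : ∀ x ∈ L, ∀ y ∈ L, ∃ k : ℤ, ⟪x, y⟫ = (k : ℝ) := fun x hx => (hL.2.2 x).1 hx
  choose N hN using fun i => hInt _ (b i).2 _ (b i).2
  refine ⟨D N, (D N).2, ?_⟩
  have key : ∀ x ∈ Submodule.span ℤ (Set.range b), ∃ k : ℤ, ⟪(D N : EuclideanSpace ℝ (Fin n)), (x : EuclideanSpace ℝ (Fin n))⟫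
      - ⟪(x : EuclideanSpace ℝ (Fin n)), (x : EuclideanSpace ℝ (Fin n))⟫ = 2 * (k : ℝ) := by
    intro x hx
    induction hx using Submodule.span_induction with
    | mem x hx =>
      obtain ⟨i, rfl⟩ := hx
      exact ⟨0, by rw [hD, hN]; simp⟩
    | zero => exact ⟨0, by simp⟩
    | add x y _ _ hx hy =>
      obtain ⟨k, hk⟩ := hx
      obtain ⟨l, hl⟩ := hy
      obtain ⟨m, hm⟩ := hInt _ x.2 _ y.2
      refine ⟨k + l - m, ?_⟩
      have hm' := hm
      rw [real_inner_comm] at hm'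
      simp only [Submodule.coe_add, inner_add_left, inner_add_right]
      push_cast
      linarith
    | smul a x _ hx =>
      obtain ⟨k, hk⟩ := hx
      obtain ⟨m, hm⟩ := hInt _ x.2 _ x.2
      have he : Even (a - a * a) := by
        rw [show a - a * a = - (a * (a - 1)) by ring]
        exact (Int.even_mul_pred_self a).neg
      obtain ⟨j, hj⟩ := he
      refine ⟨a * k + j * m, ?_⟩
      have hj' : (a : ℝ) - a * a = 2 * j := by
        have : a - a * a = 2 * j := by omega
        exact_mod_cast this
      simp only [Submodule.coe_smul]
      rw [← Int.cast_smul_eq_zsmul ℝ, inner_smul_right, inner_smul_right, inner_smul_left]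
      push_cast
      simp only [conj_trivial]
      linear_combination (a : ℝ) * hk + (a - a * a : ℝ) * hm + (m : ℝ) * hj'
  intro x hx
  exact key ⟨x, hx⟩ (by rw [b.span_eq]; trivial)

theorem gauss_cov {n : ℕ} {ι : Type*} [Fintype ι]
    (B : (ι → ℝ) ≃L[ℝ] EuclideanSpace ℝ (Fin n)) :
    ∃ c : ℝ, ∀ φ : EuclideanSpace ℝ (Fin n) → ℂ, (MeasureTheory.Integrable φ →
      MeasureTheory.Integrable (fun x => φ (B x))) ∧ ∫ x, φ (B x) = c * ∫ y, φ y := by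
  have hB : MeasurableEmbedding B := B.toHomeomorph.measurableEmbedding
  have hc := MeasureTheory.Measure.isAddLeftInvariant_eq_smul
    ((MeasureTheory.volume : MeasureTheory.Measure (ι → ℝ)).map B) (MeasureTheory.volume : MeasureTheory.Measure (EuclideanSpace ℝ (Fin n)))
  set c := MeasureTheory.Measure.addHaarScalarFactor
    ((MeasureTheory.volume : MeasureTheory.Measure (ι → ℝ)).map B) (MeasureTheory.volume : MeasureTheory.Measure (EuclideanSpace ℝ (Fin n)))
  refine ⟨c, fun φ => ⟨fun h => ?_, ?_⟩⟩
  · have := h.smul_measure_nnreal (c := c)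
    rw [← hc, hB.integrable_map_iff] at this
    exact this
  · rw [← hB.integral_map, hc, MeasureTheory.integral_smul_nnreal_measure]
    rfl

open scoped RealInnerProductSpace in
theorem lat_poisson {n : ℕ} (L : Submodule ℤ (EuclideanSpace ℝ (Fin n))) (hL : IsUnimodularLattice n L)
    [DiscreteTopology L] [IsZLattice ℝ L] :
    ∃ c : ℝ, ∀ (τ : ℂ) (u : EuclideanSpace ℝ (Fin n)), 0 < τ.im →
      ∑' v : L, cexp (π * I * τ * (‖(v : EuclideanSpace ℝ (Fin n)) + u‖ ^ 2 : ℝ)) =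
      c * (π / (-(π * I * τ))) ^ (n / 2 : ℂ) * ∑' v : L, cexp (2 * π * I * (⟪(v : EuclideanSpace ℝ (Fin n)), u⟫ : ℝ)) *
        cexp (π * I * (-1/τ) * (‖(v : EuclideanSpace ℝ (Fin n))‖ ^ 2 : ℝ)) := by
  have := ZLattice.module_finite ℝ L
  have := ZLattice.module_free ℝ L
  let b := Module.Free.chooseBasis ℤ L
  obtain ⟨D, hD⟩ := lat_dual L hL b
  let Bb := b.ofZLatticeBasis ℝ L
  have hBb : ∀ i, Bb i = (b i : EuclideanSpace ℝ (Fin n)) := b.ofZLatticeBasis_apply ℝ L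
  obtain ⟨B, hB⟩ : ∃ B : (Module.Free.ChooseBasisIndex ℤ L → ℝ) ≃L[ℝ] EuclideanSpace ℝ (Fin n),
      ∀ x, B x = ∑ i, x i • (b i : EuclideanSpace ℝ (Fin n)) := by
    refine ⟨Bb.equivFun.symm.toContinuousLinearEquiv, fun x => ?_⟩
    simp only [LinearEquiv.coe_toContinuousLinearEquiv', Module.Basis.equivFun_symm_apply, hBb]
  obtain ⟨ε, hε⟩ : ∃ ε : (Module.Free.ChooseBasisIndex ℤ L → ℤ) ≃ L,
      ∀ k, (ε k : EuclideanSpace ℝ (Fin n)) = B (fun i => (k i : ℝ)) := by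
    refine ⟨b.equivFun.symm.toEquiv, fun k => ?_⟩
    rw [hB]
    have : b.equivFun.symm.toEquiv k = ∑ i, k i • b i := b.equivFun_symm_apply k
    rw [this, AddSubmonoidClass.coe_finsetSum]
    refine Finset.sum_congr rfl fun i _ => ?_
    rw [Int.cast_smul_eq_zsmul]; rfl
  obtain ⟨c, hc⟩ := gauss_cov B
  refine ⟨c, fun τ u hτ => ?_⟩
  have hτ0 : τ ≠ 0 := by rintro rfl; simp at hτ
  have hre : 0 < (-(π * I * τ)).re := by simp; positivity
  set f : (Module.Free.ChooseBasisIndex ℤ L → ℝ) → ℂ := fun x => cexp (π * I * τ * (‖B x + u‖ ^ 2 : ℝ)) with hf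
  have hfc : Continuous f := by simp only [hf]; fun_prop
  have hfi : MeasureTheory.Integrable f := by
    refine (hc (fun y => cexp (π * I * τ * (‖y + u‖ ^ 2 : ℝ)))).1 ?_
    have := (GaussianFourier.integrable_cexp_neg_mul_sq_norm_add hre 0 (0 : EuclideanSpace ℝ (Fin n))).comp_add_right u
    refine this.congr (Eventually.of_forall fun y => ?_)
    simp
  have hbd : ∀ R : ℝ, ∃ g : (Module.Free.ChooseBasisIndex ℤ L → ℤ) → ℝ, Summable g ∧
      ∀ k x, ‖x‖ ≤ R → ‖f (x + fun i => (k i : ℝ))‖ ≤ g k := by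
    intro R
    obtain ⟨K, hK0, hK⟩ : ∃ K : ℝ, 0 ≤ K ∧ ∀ x, ‖B x‖ ≤ K * ‖x‖ :=
      ⟨‖(B : (Module.Free.ChooseBasisIndex ℤ L → ℝ) →L[ℝ] EuclideanSpace ℝ (Fin n))‖, norm_nonneg _,
        (B : (Module.Free.ChooseBasisIndex ℤ L → ℝ) →L[ℝ] EuclideanSpace ℝ (Fin n)).le_opNorm⟩
    obtain ⟨M, hM⟩ : ∃ M, M = K * R + ‖u‖ := ⟨_, rfl⟩
    refine ⟨fun k => Real.exp (π * τ.im * M ^ 2) * Real.exp (-π * (τ.im / 2) * ‖(ε k : EuclideanSpace ℝ (Fin n))‖ ^ 2), ?_, ?_⟩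
    · apply Summable.mul_left
      have := lat_summable L 0 (τ.im / 2) (by positivity)
      simp only [add_zero] at this
      exact (ε.summable_iff).2 this
    · intro k x hx
      rw [show ‖f (x + fun i => (k i : ℝ))‖ = _ from norm_gth_term _ τ]
      beta_reduce
      rw [← Real.exp_add]
      apply Real.exp_le_exp.2
      rw [map_add, ← hε]
      generalize (ε k : EuclideanSpace ℝ (Fin n)) = a
      have h1 : ‖B x + u‖ ≤ M := by
        refine (norm_add_le _ _).trans ?_
        have h2 := hK x
        have h3 := mul_le_mul_of_nonneg_left hx hK0
        linarith
      have h0 : ‖a‖ ≤ ‖B x + a + u‖ + ‖B x + u‖ := by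
        have := norm_sub_le (B x + a + u) (B x + u)
        simpa using this
      have h5 : ‖a‖ ^ 2 ≤ 2 * ‖B x + a + u‖ ^ 2 + 2 * M ^ 2 := by
        have := norm_nonneg a
        have := norm_nonneg (B x + a + u)
        have := norm_nonneg (B x + u)
        nlinarith [sq_nonneg (‖B x + a + u‖ - M)]
      have := mul_le_mul_of_nonneg_left h5 (mul_pos Real.pi_pos hτ).le
      nlinarith
  have hcoef : ∀ k : Module.Free.ChooseBasisIndex ℤ L → ℤ,
      ∫ x : Module.Free.ChooseBasisIndex ℤ L → ℝ, cexp (-(2 * π * I * ∑ i, (k i : ℂ) * x i)) * f x =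
      c * (π / (-(π * I * τ))) ^ (n / 2 : ℂ) * (cexp (2 * π * I * (⟪(D k : EuclideanSpace ℝ (Fin n)), u⟫ : ℝ)) *
        cexp (π * I * (-1/τ) * (‖(D k : EuclideanSpace ℝ (Fin n))‖ ^ 2 : ℝ))) := by
    intro k
    have e1 : ∀ x : Module.Free.ChooseBasisIndex ℤ L → ℝ, (∑ i, (k i : ℂ) * x i) = (⟪(D k : EuclideanSpace ℝ (Fin n)), B x⟫ : ℝ) := by
      intro x
      rw [hB, inner_sum]
      push_cast
      refine Finset.sum_congr rfl fun i _ => ?_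
      rw [inner_smul_right, hD]
      push_cast; ring
    simp_rw [e1, hf]
    rw [(hc (fun y => cexp (-(2 * π * I * (⟪(D k : EuclideanSpace ℝ (Fin n)), y⟫ : ℝ))) * cexp (π * I * τ * (‖y + u‖ ^ 2 : ℝ)))).2]
    generalize (D k : EuclideanSpace ℝ (Fin n)) = v
    rw [← MeasureTheory.integral_sub_right_eq_self _ u]
    have e2 : ∀ y : EuclideanSpace ℝ (Fin n), cexp (-(2 * π * I * (⟪v, y - u⟫ : ℝ))) * cexp (π * I * τ * (‖y - u + u‖ ^ 2 : ℝ)) =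
        cexp (2 * π * I * (⟪v, u⟫ : ℝ)) * cexp (-(-(π * I * τ)) * ‖y‖ ^ 2 + (-(2 * π * I)) * (⟪v, y⟫ : ℝ)) := by
      intro y
      rw [← Complex.exp_add, ← Complex.exp_add, inner_sub_right, sub_add_cancel]
      congr 1
      push_cast
      ring
    simp_rw [e2]
    rw [MeasureTheory.integral_const_mul, GaussianFourier.integral_cexp_neg_mul_sq_norm_add hre]
    rw [finrank_euclideanSpace_fin]
    have e3 : (-(2 * π * I)) ^ 2 * (‖v‖ : ℂ) ^ 2 / (4 * (-(π * I * τ))) = π * I * (-1/τ) * (‖v‖ ^ 2 : ℝ) := by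
      have : (π : ℂ) ≠ 0 := by exact_mod_cast Real.pi_ne_zero
      have := I_ne_zero
      push_cast
      field_simp
      ring
    rw [e3]
    ring
  have him : 0 < (-1/τ).im := im_neg_inv hτ
  have hsum : Summable fun v : L => cexp (2 * π * I * (⟪(v : EuclideanSpace ℝ (Fin n)), u⟫ : ℝ)) *
        cexp (π * I * (-1/τ) * (‖(v : EuclideanSpace ℝ (Fin n))‖ ^ 2 : ℝ)) := by
    apply Summable.of_norm
    have := lat_summable L 0 _ him
    simp only [add_zero] at this
    refine this.congr fun v => ?_
    rw [norm_mul, norm_gth_term, show 2 * π * I * (⟪(v : EuclideanSpace ℝ (Fin n)), u⟫ : ℝ) =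
      ((2 * π * ⟪(v : EuclideanSpace ℝ (Fin n)), u⟫ : ℝ) : ℂ) * I by push_cast; ring, Complex.norm_exp_ofReal_mul_I, one_mul]
  have hP := poisson_pi f hfc hfi hbd (by
    simp_rw [hcoef]
    apply Summable.mul_left
    exact (D.summable_iff).2 hsum)
  simp_rw [hcoef] at hP
  have h1 := hP.tsum_eq
  rw [tsum_mul_left] at h1
  rw [← ε.tsum_eq, ← D.tsum_eq, h1]
  refine tsum_congr fun k => ?_
  simp only [hf, hε]

theorem sfac_pow (z : ℂ) (n : ℕ) : sfac z ^ n = (-I * z) ^ (n / 2 : ℂ) := by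
  rw [sfac, ← Complex.cpow_nat_mul]
  congr 1; ring

open scoped RealInnerProductSpace in
theorem final_count (n : ℕ) (L : Submodule ℤ (EuclideanSpace ℝ (Fin n)))
    (hL : IsUnimodularLattice n L)
    (h1 : ∀ x ∈ L, ⟪x, x⟫ ≠ (1 : ℝ))
    (h : ∀ w : EuclideanSpace ℝ (Fin n), IsCharacteristic n L w →
      (n : ℝ) - 8 ≤ ⟪w, w⟫) :
    {w : EuclideanSpace ℝ (Fin n) | IsCharacteristic n L w ∧ ⟪w, w⟫ = (n : ℝ) - 8}.Finite ∧
    (({w : EuclideanSpace ℝ (Fin n) |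
        IsCharacteristic n L w ∧ ⟪w, w⟫ = (n : ℝ) - 8}.ncard : ℝ)) =
      (2 : ℝ) ^ ((n : ℝ) - 11) * (n : ℝ) := by
  have i1 : DiscreteTopology L := hL.1
  have i2 : IsZLattice ℝ L := ⟨hL.2.1⟩
  have hInt : ∀ x ∈ L, ∀ y ∈ L, ∃ k : ℤ, ⟪x, y⟫ = (k : ℝ) := fun x hx => (hL.2.2 x).1 hx
  obtain ⟨w, hwL, hw⟩ := lat_char L hL
  obtain ⟨c, hc⟩ := lat_poisson L hL
  set rA : L → ℝ := fun v => ‖(v : EuclideanSpace ℝ (Fin n))‖ ^ 2 with hrA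
  set rS : L → ℝ := fun v => ‖(v : EuclideanSpace ℝ (Fin n)) + (1/2 : ℝ) • w‖ ^ 2 with hrS
  have hsA : ∀ t : ℝ, 0 < t → Summable fun i => Real.exp (-π * t * rA i) := by
    intro t ht
    have := lat_summable L 0 t ht
    simpa only [add_zero] using this
  have hsS : ∀ t : ℝ, 0 < t → Summable fun i => Real.exp (-π * t * rS i) :=
    fun t ht => lat_summable L _ t ht
  have hrAi : ∀ v, ∃ k : ℤ, rA v = k := by
    intro v
    obtain ⟨k, hk⟩ := hInt _ v.2 _ v.2
    exact ⟨k, by rw [hrA, ← hk, real_inner_self_eq_norm_sq]⟩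
  -- characteristic vectors
  have hchar : ∀ v : L, IsCharacteristic n L (w + (2 : ℝ) • (v : EuclideanSpace ℝ (Fin n))) := by
    intro v
    refine ⟨?_, fun x hx => ?_⟩
    · have : (2 : ℝ) • (v : EuclideanSpace ℝ (Fin n)) = (v : EuclideanSpace ℝ (Fin n)) + v := two_smul _ _
      rw [this]
      exact L.add_mem hwL (L.add_mem v.2 v.2)
    · obtain ⟨k, hk⟩ := hw x hx
      obtain ⟨m, hm⟩ := hInt _ v.2 _ hx
      refine ⟨k + m, ?_⟩
      rw [inner_add_left, inner_smul_left, hm]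
      simp only [conj_trivial]
      push_cast
      linarith
  have hchar' : ∀ y, IsCharacteristic n L y → ∃ v : L, w + (2 : ℝ) • (v : EuclideanSpace ℝ (Fin n)) = y := by
    rintro y ⟨hy, hy'⟩
    have : (1/2 : ℝ) • (y - w) ∈ L := by
      rw [hL.2.2]
      intro x hx
      obtain ⟨k, hk⟩ := hw x hx
      obtain ⟨m, hm⟩ := hy' x hx
      refine ⟨m - k, ?_⟩
      rw [inner_smul_left, inner_sub_left]
      simp only [conj_trivial]
      push_cast
      linarith
    refine ⟨⟨_, this⟩, ?_⟩
    simp only [smul_smul]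
    norm_num
  have hnorm : ∀ v : L, ⟪w + (2 : ℝ) • (v : EuclideanSpace ℝ (Fin n)), w + (2 : ℝ) • (v : EuclideanSpace ℝ (Fin n))⟫ = 4 * rS v := by
    intro v
    have : w + (2 : ℝ) • (v : EuclideanSpace ℝ (Fin n)) = (2 : ℝ) • ((v : EuclideanSpace ℝ (Fin n)) + (1/2 : ℝ) • w) := by
      rw [smul_add, smul_smul]; norm_num [add_comm]
    rw [this, real_inner_self_eq_norm_sq, norm_smul]
    simp only [hrS]
    rw [mul_pow]; norm_num
  have hfinS : {v : L | rS v = ((n : ℝ) - 8) / 4}.Finite :=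
    (gth_finite hsS (((n : ℝ) - 8) / 4)).subset fun v hv => le_of_eq hv
  set S := hfinS.toFinset with hS
  have himg : {w : EuclideanSpace ℝ (Fin n) | IsCharacteristic n L w ∧ ⟪w, w⟫ = (n : ℝ) - 8} =
      Set.image (fun v : L => w + (2 : ℝ) • (v : EuclideanSpace ℝ (Fin n))) {v : L | rS v = ((n : ℝ) - 8) / 4} := by
    ext y
    constructor
    · rintro ⟨hy, hy'⟩
      obtain ⟨v, rfl⟩ := hchar' y hy
      refine ⟨v, ?_, rfl⟩
      rw [hnorm] at hy'
      change rS v = _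
      linarith
    · rintro ⟨v, hv, rfl⟩
      refine ⟨hchar v, ?_⟩
      rw [hnorm]
      have hv' : rS v = ((n : ℝ) - 8) / 4 := hv
      linarith
  have hinj : Function.Injective (fun v : L => w + (2 : ℝ) • (v : EuclideanSpace ℝ (Fin n))) := by
    intro v v' hvv
    have h2 : (2 : ℝ) • (v : EuclideanSpace ℝ (Fin n)) = (2 : ℝ) • (v' : EuclideanSpace ℝ (Fin n)) := add_left_cancel hvv
    exact Subtype.ext (smul_right_injective _ (two_ne_zero (α := ℝ)) h2)
  have hcard : {w : EuclideanSpace ℝ (Fin n) | IsCharacteristic n L w ∧ ⟪w, w⟫ = (n : ℝ) - 8}.ncard = S.card := by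
    rw [himg, Set.ncard_image_of_injective _ hinj, Set.ncard_eq_toFinset_card _ hfinS]
  -- lower bound for the others
  have hgap : ∀ v, v ∉ S → ((n : ℝ) - 7) / 4 ≤ rS v := by
    intro v hv
    have h2 := h _ (hchar v)
    obtain ⟨k, hk⟩ := hInt _ (hchar v).1 _ (hchar v).1
    have h3 : ¬ (rS v = ((n : ℝ) - 8) / 4) := fun hh => hv (by simpa [hS] using hh)
    rw [hk] at h2
    rw [hnorm] at hk
    have h4 : (n : ℤ) - 8 ≤ k := by exact_mod_cast h2
    have h5 : (n : ℤ) - 8 ≠ k := by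
      intro hh
      apply h3
      have : (n : ℝ) - 8 = k := by exact_mod_cast hh
      linarith
    have h6 : (n : ℤ) - 7 ≤ k := by omega
    have h7 : (n : ℝ) - 7 ≤ k := by exact_mod_cast h6
    linarith
  have hrA2 : ∀ v : L, v ∉ ({0} : Finset L) → 2 ≤ rA v := by
    intro v hv
    have hv0 : v ≠ 0 := by simpa using hv
    have hpos : 0 < rA v := by
      simp only [hrA]
      have : 0 < ‖(v : EuclideanSpace ℝ (Fin n))‖ := norm_pos_iff.2 (by simpa using hv0)
      positivity
    have hne : rA v ≠ 1 := by
      have := h1 _ v.2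
      rwa [real_inner_self_eq_norm_sq] at this
    obtain ⟨k, hk⟩ := hrAi v
    rw [hk] at hpos hne ⊢
    have h4 : 0 < k := by exact_mod_cast hpos
    have h5 : k ≠ 1 := by exact_mod_cast hne
    have h6 : 2 ≤ k := by omega
    exact_mod_cast h6
  -- functional equations
  have hAS0 : ∀ z : ℂ, 0 < z.im → gth rA (-1/z) = c * (sfac z ^ n * gth rA z) := by
    intro z hz
    have hz0 : z ≠ 0 := by rintro rfl; simp at hz
    have hpi : (π : ℂ) ≠ 0 := by exact_mod_cast Real.pi_ne_zero
    have := hc (-1/z) 0 (im_neg_inv hz)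
    simp only [add_zero, inner_zero_right, ofReal_zero, mul_zero, Complex.exp_zero, one_mul] at this
    rw [show -1 / (-1 / z) = z by field_simp,
      show π / (-(π * I * (-1/z))) = -I * z by
        have := I_ne_zero
        field_simp
        rw [I_sq]; ring, ← sfac_pow] at this
    rw [← mul_assoc]
    exact this
  have hc1 : (c : ℂ) = 1 := by
    have h2 := hAS0 I (by simp)
    have e1 : -1 / I = I := by rw [div_eq_iff I_ne_zero, I_mul_I]
    have e2 : sfac I = 1 := by rw [sfac]; simp
    rw [e1, e2, one_pow, one_mul] at h2
    have h3 : gth rA I ≠ 0 := by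
      have hre : gth rA I = ((∑' v, Real.exp (-π * 1 * rA v) : ℝ) : ℂ) := by
        rw [ofReal_tsum]
        unfold gth
        refine tsum_congr fun v => ?_
        rw [ofReal_exp]
        congr 1
        push_cast
        linear_combination (π * (rA v : ℂ)) * I_sq
      rw [hre]
      have := (hsA 1 one_pos).tsum_pos (fun v => (Real.exp_pos _).le) 0 (Real.exp_pos _)
      exact_mod_cast this.ne'
    have h4 : (c - 1 : ℂ) * gth rA I = 0 := by linear_combination -h2
    rcases mul_eq_zero.1 h4 with h5 | h5
    · linear_combination h5
    · exact absurd h5 h3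
  have hAS : ∀ z : ℂ, 0 < z.im → gth rA (-1/z) = sfac z ^ n * gth rA z := by
    intro z hz
    rw [hAS0 z hz, hc1, one_mul]
  have hA2 : ∀ z : ℂ, 0 < z.im → gth rA (z + 2) = gth rA z := by
    intro z _
    unfold gth
    refine tsum_congr fun v => ?_
    obtain ⟨k, hk⟩ := hrAi v
    rw [hk, show π * I * (z + 2) * ((k : ℝ) : ℂ) = π * I * z * ((k : ℝ) : ℂ) + π * I * ((2 * k : ℤ) : ℂ) by
      push_cast; ring, Complex.exp_add, cexp_pi_int_even _ (even_two_mul k), mul_one]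
  have hA1 : ∀ z : ℂ, 0 < z.im → gth rA (1 - 1/z) = sfac z ^ n * gth rS z := by
    intro z hz
    have hz0 : z ≠ 0 := by rintro rfl; simp at hz
    have hpi : (π : ℂ) ≠ 0 := by exact_mod_cast Real.pi_ne_zero
    have hP := hc z ((1/2 : ℝ) • w) hz
    rw [hc1, one_mul] at hP
    have e1 : gth rS z = ∑' v : L, cexp (π * I * z * (‖(v : EuclideanSpace ℝ (Fin n)) + (1/2 : ℝ) • w‖ ^ 2 : ℝ)) := rfl
    rw [e1, hP]
    have e2 : sfac z ^ n * (π / (-(π * I * z))) ^ (n / 2 : ℂ) = 1 := by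
      rw [sfac_pow, show π / (-(π * I * z)) = (-I * z)⁻¹ by
        have := I_ne_zero
        field_simp]
      have harg : (-I * z).arg ≠ π := by
        have : 0 < (-I * z).re := by simpa using hz
        intro hh
        rw [Complex.arg_eq_pi_iff] at hh
        linarith [hh.1]
      rw [Complex.inv_cpow _ _ harg]
      apply mul_inv_cancel₀
      rw [← sfac_pow]
      exact pow_ne_zero _ (sfac_ne hz)
    rw [← mul_assoc, e2, one_mul]
    unfold gth
    refine tsum_congr fun v => ?_
    rw [inner_smul_right, real_inner_comm]
    obtain ⟨k, hk⟩ := hw v v.2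
    rw [real_inner_self_eq_norm_sq] at hk
    have hk' : ⟪w, (v : EuclideanSpace ℝ (Fin n))⟫ = rA v + 2 * k := by simp only [hrA]; linarith
    rw [hk', ← Complex.exp_add]
    rw [show 2 * π * I * ((1/2 * (rA v + 2 * k) : ℝ) : ℂ) + π * I * (-1/z) * (‖(v : EuclideanSpace ℝ (Fin n))‖ ^ 2 : ℝ)
      = π * I * (1 - 1/z) * (rA v : ℂ) + π * I * ((2 * k : ℤ) : ℂ) by
        simp only [hrA]; push_cast; ring, Complex.exp_add, cexp_pi_int_even _ (even_two_mul k), mul_one]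
  have hA0 : (fun τ : ℍ => gth rA τ - 1) =O[atImInfty] fun τ : ℍ => Real.exp (-π * 2 * τ.im) := by
    have := gth_asym hsA {0} 2 hrA2
    refine this.congr_left fun τ => ?_
    simp [hrA]
  have hSh : Tendsto (fun τ : ℍ => gth rS τ * cexp (-(π * I * τ * (n - 8) / 4))) atImInfty (𝓝 (S.card : ℂ)) := by
    have h2 := gth_asym hsS S (((n : ℝ) - 7) / 4) hgap
    have h3 := h2.mul (isBigO_refl (fun τ : ℍ => cexp (-(π * I * τ * (n - 8) / 4))) atImInfty).norm_right
    have h4 : (fun τ : ℍ => gth rS τ * cexp (-(π * I * τ * (n - 8) / 4)) - S.card) =O[atImInfty]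
        (fun τ : ℍ => Real.exp (-(π/4) * τ.im)) := by
      refine (h3.congr_left fun τ => ?_).trans ?_
      · rw [sub_mul]
        congr 1
        rw [Finset.sum_mul, Finset.sum_congr rfl (g := fun _ => (1:ℂ))]
        · simp
        · intro v hv
          have : rS v = ((n : ℝ) - 8) / 4 := by simpa [hS] using hv
          rw [this, ← Complex.exp_add, ← Complex.exp_zero]
          congr 1
          push_cast; ring
      · refine IsBigO.of_bound 1 (Eventually.of_forall fun τ => ?_)
        rw [norm_mul, one_mul]
        have e : cexp (-(π * I * τ * (n - 8) / 4)) = cexp (π * I * τ * ((-((n : ℝ) - 8)/4 : ℝ) : ℂ)) := by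
          congr 1; push_cast; ring
        rw [e, norm_gth_term]
        simp only [Real.norm_eq_abs, Real.abs_exp]
        rw [← Real.exp_add]
        apply Real.exp_le_exp.2
        have : (τ : ℂ).im = τ.im := rfl
        rw [this]
        apply le_of_eq
        ring
    have h5 : Tendsto (fun τ : ℍ => Real.exp (-(π/4) * τ.im)) atImInfty (𝓝 0) := by
      have hp : 0 < π / 4 := by positivity
      simpa using tendsto_exp_im hp
    have h6 := h4.trans_tendsto h5
    exact tendsto_sub_nhds_zero_iff.1 h6
  have hfin := partE n (gth rA) (gth rS) (S.card : ℂ)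
    (gth_diff (fun v => sq_nonneg _) hsA) hA2 hAS hA1 hA0 hSh
  refine ⟨by rw [himg]; exact hfinS.image _, ?_⟩
  rw [hcard]
  have hreal : (S.card : ℝ) * 2 ^ 8 = (n / 8) * 2 ^ n := by
    apply Complex.ofReal_injective
    push_cast
    exact hfin
  rw [Real.rpow_sub two_pos, Real.rpow_natCast]
  have : (2:ℝ) ^ (11 : ℝ) = 2048 := by norm_num
  rw [this]
  linarith

end Helpers

/-- If a unimodular lattice in `ℝⁿ` has no vectors of norm 1 and all its characteristic
vectors have norm at least `n − 8`, then the number of characteristic vectors of norm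
exactly `n − 8` equals `2^(n−11) · n` (as real numbers, with a real power `2^(n−11)`
that is meaningful also for `n < 11`). -/
theorem card_characteristic_min_norm (n : ℕ) (L : Submodule ℤ (EuclideanSpace ℝ (Fin n)))
    (hL : IsUnimodularLattice n L)
    (h1 : ∀ x ∈ L, ⟪x, x⟫ ≠ (1 : ℝ))
    (h : ∀ w : EuclideanSpace ℝ (Fin n), IsCharacteristic n L w →
      (n : ℝ) - 8 ≤ ⟪w, w⟫) :
    {w : EuclideanSpace ℝ (Fin n) | IsCharacteristic n L w ∧ ⟪w, w⟫ = (n : ℝ) - 8}.Finite ∧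
    (({w : EuclideanSpace ℝ (Fin n) |
        IsCharacteristic n L w ∧ ⟪w, w⟫ = (n : ℝ) - 8}.ncard : ℝ)) =
      (2 : ℝ) ^ ((n : ℝ) - 11) * (n : ℝ) := by
  exact final_count n L hL h1 h
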